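/- For every α ∈ V* there exist d ∈ 𝔻 and u ∈ V such that (d,(u,α)) ∈ F; equivalently, the projection map F → V*, (d,(u,α)) ↦ α, is surjective. (This is the fibrewise linear-algebra content of Lemma 3.2(ii) of the paper.) -/

import Mathlib

/-- The symmetric bilinear pairing on `E = 𝔻 × (V × V*)`:
`⟪(d₁,(u₁,α₁)),(d₂,(u₂,α₂))⟫ = ⟨d₁,d₂⟩ + (1/2)(α₁(u₂) + α₂(u₁))`. -/
noncomputable def pairE {D V : Type*} [AddCommGroup D] [Module ℝ D] [AddCommGroup V] [Module ℝ V]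
    (B : LinearMap.BilinForm ℝ D) (p q : D × V × Module.Dual ℝ V) : ℝ :=
  B p.1 q.1 + (1 / 2) * (p.2.2 q.2.1 + q.2.2 p.2.1)

theorem stmt
    {D V : Type*} [AddCommGroup D] [Module ℝ D] [FiniteDimensional ℝ D]
    [AddCommGroup V] [Module ℝ V] [FiniteDimensional ℝ V]
    (B : LinearMap.BilinForm ℝ D) (hBsymm : B.IsSymm) (hBnd : B.Nondegenerate)
    (A : Submodule ℝ D)
    -- `A = A^⊥` (A is Lagrangian in 𝔻)
    (hA : (A : Set D) = {d : D | ∀ a ∈ A, B d a = 0})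
    (F : Submodule ℝ (D × V × Module.Dual ℝ V))
    -- `F = F^⊥` with respect to the pairing `pairE B` (F is Lagrangian in E)
    (hF : (F : Set (D × V × Module.Dual ℝ V)) =
      {e : D × V × Module.Dual ℝ V | ∀ f ∈ F, pairE B e f = 0})
    -- (i) `F` intersects `{0} × (V × {0})` trivially
    (hFi : ∀ u : V, ((0 : D), u, (0 : Module.Dual ℝ V)) ∈ F → u = 0)
    -- (ii) the image of `F ∩ (𝔻 × (V × {0}))` under the projection `E → 𝔻` equals `A`
    (hFii : ∀ d : D, d ∈ A ↔ ∃ u : V, (d, u, (0 : Module.Dual ℝ V)) ∈ F)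
    :
    ∀ α : Module.Dual ℝ V, ∃ (d : D) (u : V), (d, u, α) ∈ F := by
  let W : Submodule ℝ (Module.Dual ℝ V) :=
    F.map (LinearMap.snd ℝ V (Module.Dual ℝ V) ∘ₗ LinearMap.snd ℝ D (V × Module.Dual ℝ V))
  have hcoann : W.dualCoannihilator = ⊥ := by
    refine (Submodule.eq_bot_iff _).2 fun u hu => hFi u ?_
    rw [Submodule.mem_dualCoannihilator] at hu
    rw [← SetLike.mem_coe, hF]
    intro f hf
    have h : f.2.2 u = 0 := hu _ (Submodule.mem_map_of_mem hf)
    simp [pairE, h]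
  have hWtop : W = ⊤ := by
    rw [← Subspace.dualCoannihilator_dualAnnihilator_eq (W := W), hcoann,
      Submodule.dualAnnihilator_bot]
  intro α
  obtain ⟨⟨d, u, β⟩, hf, rfl⟩ : α ∈ W := hWtop ▸ Submodule.mem_top
  exact ⟨d, u, hf⟩
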